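/- arXiv:1411.6832 — 3 statements merged into one kernel-verified Lean document; each statement's English description precedes it below -/
import Mathlib

section
/- Let G be a connected simple graph on n ≥ 2 vertices and let v_r, v_s be two distinct vertices such that N_G(v_r) \ {v_s} = N_G(v_s) \ {v_r}, where N_G(v) denotes the neighborhood of v. Then every eigenvector X = (x_1,...,x_n) of the Harary matrix RD(G) corresponding to the eigenvalue ρ(G) satisfies x_r = x_s. -/
open scoped Classical

noncomputable def hararyMatrix {V : Type*} [Finite V] (G : SimpleGraph V) : Matrix V V ℝ :=
  Matrix.of fun i j => if i = j then 0 else ((G.dist i j : ℝ))⁻¹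

noncomputable def hararyRho {V : Type*} [Finite V] (G : SimpleGraph V) : ℝ :=
  letI := Fintype.ofFinite V
  sSup {μ : ℝ | Module.End.HasEigenvalue (Matrix.toLin' (hararyMatrix G)) μ}

theorem dist_le_dist_of_neighborSet_sdiff_subset {V : Type*} {G : SimpleGraph V}
    (hG : G.Connected) {r s k : V} (hks : k ≠ s)
    (hnbhd : G.neighborSet s \ {r} ⊆ G.neighborSet r) :
    G.dist r k ≤ G.dist s k := by
  obtain ⟨p, hp⟩ := hG.exists_walk_length_eq_dist s k
  cases p with
  | nil => exact absurd rfl hks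
  | @cons _ v _ hsv q =>
    have hvk := SimpleGraph.dist_le q
    rw [SimpleGraph.Walk.length_cons] at hp
    by_cases hvr : v = r
    · subst hvr
      omega
    · have hrv : G.Adj r v := hnbhd ⟨hsv, hvr⟩
      have hwalk := SimpleGraph.dist_le (SimpleGraph.Walk.cons hrv q)
      rw [SimpleGraph.Walk.length_cons] at hwalk
      omega

theorem Matrix.IsHermitian.exists_nonneg_hasEigenvalue {n : Type*} [Fintype n] [Nonempty n]
    {A : Matrix n n ℝ} (hA : A.IsHermitian) (htr : A.trace = 0) :
    ∃ μ, Module.End.HasEigenvalue (Matrix.toLin' A) μ ∧ 0 ≤ μ := by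
  have hsum : ∑ _i : n, (0 : ℝ) ≤ ∑ i, hA.eigenvalues i := by
    have htrace := hA.trace_eq_sum_eigenvalues
    rw [htr] at htrace
    simpa using htrace.le
  obtain ⟨i, -, hi⟩ := Finset.exists_le_of_sum_le Finset.univ_nonempty hsum
  refine ⟨hA.eigenvalues i, ?_, hi⟩
  rw [Module.End.hasEigenvalue_iff_mem_spectrum, Matrix.spectrum_toLin']
  exact hA.eigenvalues_mem_spectrum_real i

theorem hararyMatrix_isHermitian {V : Type*} [Finite V] (G : SimpleGraph V) :
    (hararyMatrix G).IsHermitian := by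
  ext i j
  simp [hararyMatrix, SimpleGraph.dist_comm, eq_comm]

theorem hararyRho_nonneg {V : Type*} [Finite V] [Nonempty V] (G : SimpleGraph V) :
    0 ≤ hararyRho G := by
  let := Fintype.ofFinite V
  have htr : (hararyMatrix G).trace = 0 := by simp [Matrix.trace, hararyMatrix]
  exact Real.sSup_nonneg' ((hararyMatrix_isHermitian G).exists_nonneg_hasEigenvalue htr)

/-- If two distinct vertices have the same neighborhoods (apart from each other), then every
eigenvector of the Harary matrix corresponding to the Harary spectral radius has equal
entries at the two vertices. -/
theorem harary_eigenvector_eq_of_same_nbhd {V : Type*} [Fintype V] (G : SimpleGraph V)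
    (hG : G.Connected) (r s : V) (hrs : r ≠ s)
    (hnbhd : G.neighborSet r \ {s} = G.neighborSet s \ {r})
    (X : V → ℝ) (hX : X ≠ 0)
    (heig : (hararyMatrix G).mulVec X = hararyRho G • X) :
    X r = X s := by
  have : Nonempty V := ⟨r⟩
  have hdist : ∀ k, k ≠ r → k ≠ s → G.dist r k = G.dist s k := fun k hkr hks =>
    (dist_le_dist_of_neighborSet_sdiff_subset hG hks (hnbhd ▸ Set.sdiff_subset)).antisymm
      (dist_le_dist_of_neighborSet_sdiff_subset hG hkr (hnbhd ▸ Set.sdiff_subset))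
  have hdpos : (0 : ℝ) < (G.dist r s : ℝ)⁻¹ :=
    inv_pos.mpr (Nat.cast_pos.mpr (hG.pos_dist_of_ne hrs))
  have hrow : (hararyMatrix G).mulVec X r - (hararyMatrix G).mulVec X s =
      (G.dist r s : ℝ)⁻¹ * (X s - X r) := by
    simp only [Matrix.mulVec, dotProduct, ← Finset.sum_sub_distrib]
    rw [Finset.sum_eq_add r s hrs]
    · simp only [hararyMatrix, Matrix.of_apply, if_pos, if_neg hrs, if_neg hrs.symm,
        G.dist_comm (u := s)]
      ring
    · rintro k - ⟨hkr, hks⟩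
      simp [hararyMatrix, hkr.symm, hks.symm, hdist k hkr hks]
    · simp
    · simp
  rw [heig] at hrow
  simp only [Pi.smul_apply, smul_eq_mul] at hrow
  have hprod : (hararyRho G + (G.dist r s : ℝ)⁻¹) * (X r - X s) = 0 := by linarith
  have hpos := add_pos_of_nonneg_of_pos (hararyRho_nonneg G) hdpos
  exact sub_eq_zero.mp ((mul_eq_zero.mp hprod).resolve_left hpos.ne')
end

section
/- Let n ≥ 2 and let a, b be integers with 1 ≤ a < b ≤ ⌊n/2⌋. Then ρ(K_{a,n−a}) < ρ(K_{b,n−b}); in particular ρ(K_{1,n−1}) < ρ(K_{2,n−2}) < ... < ρ(K_{⌊n/2⌋,⌈n/2⌉}). -/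
open scoped Classical

theorem dist_completeBipartiteGraph_inl_inr {V W : Type*} (v : V) (w : W) :
    (completeBipartiteGraph V W).dist (Sum.inl v) (Sum.inr w) = 1 := by
  rw [SimpleGraph.dist_eq_one_iff_adj]
  simp

theorem dist_completeBipartiteGraph_inr_inl {V W : Type*} (v : V) (w : W) :
    (completeBipartiteGraph V W).dist (Sum.inr w) (Sum.inl v) = 1 := by
  rw [SimpleGraph.dist_comm, dist_completeBipartiteGraph_inl_inr]

theorem SimpleGraph.dist_eq_two_of_common_neighbor {V : Type*} {G : SimpleGraph V} {u v w : V}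
    (huv : u ≠ v) (hn : ¬ G.Adj u v) (huw : G.Adj u w) (hwv : G.Adj w v) : G.dist u v = 2 := by
  have hle : G.dist u v ≤ 2 :=
    SimpleGraph.dist_le (SimpleGraph.Walk.cons huw (SimpleGraph.Walk.cons hwv .nil))
  have hpos : 0 < G.dist u v := (huw.reachable.trans hwv.reachable).pos_dist_of_ne huv
  have hne : G.dist u v ≠ 1 := fun h => hn (SimpleGraph.dist_eq_one_iff_adj.1 h)
  omega

theorem dist_completeBipartiteGraph_inl_inl {V W : Type*} [Nonempty W] {v w : V} (h : v ≠ w) :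
    (completeBipartiteGraph V W).dist (Sum.inl v) (Sum.inl w) = 2 :=
  SimpleGraph.dist_eq_two_of_common_neighbor (w := Sum.inr (Classical.arbitrary W))
    (by simpa using h) (by simp) (by simp) (by simp)

theorem dist_completeBipartiteGraph_inr_inr {V W : Type*} [Nonempty V] {v w : W} (h : v ≠ w) :
    (completeBipartiteGraph V W).dist (Sum.inr v) (Sum.inr w) = 2 :=
  SimpleGraph.dist_eq_two_of_common_neighbor (w := Sum.inl (Classical.arbitrary V))
    (by simpa using h) (by simp) (by simp) (by simp)

theorem sum_ite_eq_zero_half_mul {ι : Type*} [Fintype ι] (i : ι) (f : ι → ℝ) :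
    ∑ j, (if i = j then 0 else (2 : ℝ)⁻¹) * f j = (∑ j, f j) / 2 - f i / 2 := by
  have h : ∀ j, (if i = j then 0 else (2 : ℝ)⁻¹) * f j
      = f j / 2 - (if i = j then f j / 2 else 0) := by
    intro j
    split_ifs <;> ring
  simp [h, Finset.sum_sub_distrib, Finset.sum_div]

section

variable {V W : Type*} [Fintype V] [Fintype W]

theorem hararyMatrix_completeBipartiteGraph_mulVec_inl [Nonempty W] (x : V ⊕ W → ℝ) (v : V) :
    (hararyMatrix (completeBipartiteGraph V W)).mulVec x (Sum.inl v) =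
      (∑ j, x (Sum.inl j)) / 2 - x (Sum.inl v) / 2 + ∑ j, x (Sum.inr j) := by
  rw [← sum_ite_eq_zero_half_mul v fun j => x (Sum.inl j)]
  simp only [Matrix.mulVec, dotProduct, hararyMatrix, Matrix.of_apply, Fintype.sum_sum_type]
  congr 1
  · refine Finset.sum_congr rfl fun j _ => ?_
    by_cases h : v = j
    · simp [h]
    · simp [h, dist_completeBipartiteGraph_inl_inl h]
  · simp [dist_completeBipartiteGraph_inl_inr]

theorem hararyMatrix_completeBipartiteGraph_mulVec_inr [Nonempty V] (x : V ⊕ W → ℝ) (w : W) :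
    (hararyMatrix (completeBipartiteGraph V W)).mulVec x (Sum.inr w) =
      ∑ j, x (Sum.inl j) + ((∑ j, x (Sum.inr j)) / 2 - x (Sum.inr w) / 2) := by
  rw [← sum_ite_eq_zero_half_mul w fun j => x (Sum.inr j)]
  simp only [Matrix.mulVec, dotProduct, hararyMatrix, Matrix.of_apply, Fintype.sum_sum_type]
  congr 1
  · simp [dist_completeBipartiteGraph_inr_inl]
  · refine Finset.sum_congr rfl fun j _ => ?_
    by_cases h : w = j
    · simp [h]
    · simp [h, dist_completeBipartiteGraph_inr_inr h]

theorem isGreatest_eigenvalue_hararyMatrix_completeBipartiteGraph [Nonempty V] [Nonempty W]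
    {p q : ℝ} (hp : p = Fintype.card V) (hq : q = Fintype.card W) :
    IsGreatest {μ : ℝ | Module.End.HasEigenvalue
        (Matrix.toLin' (hararyMatrix (completeBipartiteGraph V W))) μ}
      (((p + q) / 2 + √((p + q) ^ 2 / 4 + 3 * p * q)) / 2 - 1 / 2) := by
  have hp0 : 0 < p := by rw [hp]; exact_mod_cast Fintype.card_pos
  have hq0 : 0 < q := by rw [hq]; exact_mod_cast Fintype.card_pos
  have hD : 0 ≤ (p + q) ^ 2 / 4 + 3 * p * q := by positivity
  have hs := Real.sq_sqrt hD
  have hs0 := Real.sqrt_nonneg ((p + q) ^ 2 / 4 + 3 * p * q)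
  constructor
  · set s := √((p + q) ^ 2 / 4 + 3 * p * q)
    refine Module.End.hasEigenvalue_of_hasEigenvector
      (x := Sum.elim (fun _ => q) (fun _ => ((p + q) / 2 + s) / 2 - p / 2))
      (Module.End.hasEigenvector_iff.2 ⟨Module.End.mem_eigenspace_iff.2 ?_, fun h => ?_⟩)
    · rw [Matrix.toLin'_apply]
      funext i
      rcases i with v | w
      · rw [hararyMatrix_completeBipartiteGraph_mulVec_inl]
        simp [← hp, ← hq]
        ring
      · rw [hararyMatrix_completeBipartiteGraph_mulVec_inr]
        simp [← hp, ← hq]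
        linear_combination (-1 / 4) * hs
    · have := congrFun h (Sum.inl (Classical.arbitrary V))
      simp [hq0.ne'] at this
  · intro μ hμ
    obtain ⟨x, hx⟩ := Module.End.HasEigenvalue.exists_hasEigenvector hμ
    have hx0 := hx.2
    have hxe := hx.apply_eq_smul
    rw [Matrix.toLin'_apply] at hxe
    by_contra! hlt
    have hμ0 : 0 < μ + 1 / 2 := by linarith
    set A := ∑ j, x (Sum.inl j) with hA
    set B := ∑ j, x (Sum.inr j) with hB
    have hl : ∀ v, (μ + 1 / 2) * x (Sum.inl v) = A / 2 + B := fun v => by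
      have h := congrFun hxe (Sum.inl v)
      rw [hararyMatrix_completeBipartiteGraph_mulVec_inl] at h
      simp only [Pi.smul_apply, smul_eq_mul] at h
      linarith
    have hr : ∀ w, (μ + 1 / 2) * x (Sum.inr w) = A + B / 2 := fun w => by
      have h := congrFun hxe (Sum.inr w)
      rw [hararyMatrix_completeBipartiteGraph_mulVec_inr] at h
      simp only [Pi.smul_apply, smul_eq_mul] at h
      linarith
    have h1 : (μ + 1 / 2) * A = p * (A / 2 + B) := by
      rw [hA, Finset.mul_sum, Finset.sum_congr rfl fun v _ => hl v]
      simp [hp, ← hA, mul_add]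
    have h2 : (μ + 1 / 2) * B = q * (A + B / 2) := by
      rw [hB, Finset.mul_sum, Finset.sum_congr rfl fun v _ => hr v]
      simp [hq, ← hB, mul_add]
    have hdet : (μ + 1 / 2 - p / 2) * (μ + 1 / 2 - q / 2) - p * q ≠ 0 := by
      intro h
      have hsq : (2 * (μ + 1 / 2) - (p + q) / 2) ^ 2 = (p + q) ^ 2 / 4 + 3 * p * q := by
        linear_combination 4 * h
      have := Real.abs_le_sqrt hsq.le
      have := le_abs_self (2 * (μ + 1 / 2) - (p + q) / 2)
      linarith
    have hA0 : A = 0 := by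
      refine (mul_eq_zero.1 ?_).resolve_left hdet
      linear_combination (μ + 1 / 2 - q / 2) * h1 + p * h2
    have hB0 : B = 0 := by
      refine (mul_eq_zero.1 ?_).resolve_left hdet
      linear_combination (μ + 1 / 2 - p / 2) * h2 + q * h1
    refine hx0 (funext fun i => ?_)
    rcases i with v | w
    · exact (mul_eq_zero.1 ((hl v).trans (by simp [hA0, hB0]))).resolve_left hμ0.ne'
    · exact (mul_eq_zero.1 ((hr w).trans (by simp [hA0, hB0]))).resolve_left hμ0.ne'

theorem hararyRho_completeBipartiteGraph [Nonempty V] [Nonempty W] :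
    hararyRho (completeBipartiteGraph V W) =
      (((Fintype.card V : ℝ) + Fintype.card W) / 2 +
        √(((Fintype.card V : ℝ) + Fintype.card W) ^ 2 / 4 +
          3 * Fintype.card V * Fintype.card W)) / 2 - 1 / 2 := by
  rw [← (isGreatest_eigenvalue_hararyMatrix_completeBipartiteGraph (V := V) (W := W)
    rfl rfl).csSup_eq, hararyRho]
  congr!

end

/-- The Harary spectral radius of `K_{a,n-a}` is strictly increasing in `a` for
`1 ≤ a < b ≤ ⌊n/2⌋`. -/
theorem harary_rho_completeBipartite_strictMono (n a b : ℕ) (hn : 2 ≤ n)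
    (ha : 1 ≤ a) (hab : a < b) (hb : b ≤ n / 2) :
    hararyRho (completeBipartiteGraph (Fin a) (Fin (n - a))) <
      hararyRho (completeBipartiteGraph (Fin b) (Fin (n - b))) := by
  have : NeZero a := ⟨by omega⟩
  have : NeZero b := ⟨by omega⟩
  have : NeZero (n - a) := ⟨by omega⟩
  have : NeZero (n - b) := ⟨by omega⟩
  rw [hararyRho_completeBipartiteGraph, hararyRho_completeBipartiteGraph]
  simp only [Fintype.card_fin]
  rw [Nat.cast_sub (by omega : a ≤ n), Nat.cast_sub (by omega : b ≤ n),
    add_sub_cancel, add_sub_cancel]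
  have hab' : (a : ℝ) < b := by exact_mod_cast hab
  have hsum : (a : ℝ) + b < n := by exact_mod_cast (by omega : a + b < n)
  have ha0 : (0 : ℝ) ≤ a := Nat.cast_nonneg a
  have hna : (0 : ℝ) ≤ n - a := by linarith [(Nat.cast_nonneg b : (0 : ℝ) ≤ b)]
  have hlt : √((n : ℝ) ^ 2 / 4 + 3 * a * (n - a)) < √((n : ℝ) ^ 2 / 4 + 3 * b * (n - b)) := by
    refine Real.sqrt_lt_sqrt (by positivity) ?_
    nlinarith [mul_pos (sub_pos.2 hab') (sub_pos.2 hsum)]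
  linarith
end

section
/- Let G be a connected bipartite simple graph on n vertices with matching number α'(G) = p, and suppose G is not isomorphic to the complete bipartite graph K_{p,n−p}. Then ρ(G) < ρ(K_{p,n−p}). -/
open scoped Classical

/-- The matching number of a graph: the largest number of edges in a matching. -/
noncomputable def matchingNumber {V : Type*} [Finite V] (G : SimpleGraph V) : ℕ :=
  sSup {m | ∃ M : G.Subgraph, M.IsMatching ∧ M.edgeSet.ncard = m}

section

open Finset Matrix

/-- The largest eigenvalue of a real symmetric matrix is attained and bounds the quadratic form. -/
lemma sSup_eigenvalue_spec {V : Type*} [Fintype V] [Nonempty V] (M : Matrix V V ℝ)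
    (hM : M.IsHermitian) :
    (sSup {μ : ℝ | Module.End.HasEigenvalue (Matrix.toLin' M) μ} • (1 : Matrix V V ℝ)
        - M).PosSemidef
      ∧ ∃ x : V → ℝ, x ≠ 0 ∧
        M *ᵥ x = sSup {μ : ℝ | Module.End.HasEigenvalue (Matrix.toLin' M) μ} • x := by
  have hset : {μ : ℝ | Module.End.HasEigenvalue (Matrix.toLin' M) μ} = spectrum ℝ M := by
    ext μ
    rw [Set.mem_ofPred_eq, Module.End.hasEigenvalue_iff_mem_spectrum, Matrix.spectrum_toLin']
  have hfin : (spectrum ℝ M).Finite := Matrix.finite_real_spectrum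
  have hne : (spectrum ℝ M).Nonempty :=
    ⟨_, hM.eigenvalues_mem_spectrum_real (Classical.arbitrary V)⟩
  rw [hset]
  set L := sSup (spectrum ℝ M) with hL
  have hmem : L ∈ spectrum ℝ M := hne.csSup_mem hfin
  refine ⟨?_, ?_⟩
  · rw [Matrix.posSemidef_iff_isHermitian_and_spectrum_nonneg]
    refine ⟨(isHermitian_one.smul (IsSelfAdjoint.all L)).sub hM, ?_⟩
    rw [← Algebra.algebraMap_eq_smul_one, ← spectrum.singleton_sub_eq]
    rintro μ ⟨a, rfl, b, hb, rfl⟩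
    simpa using le_csSup hfin.bddAbove hb
  · rw [← hset] at hmem
    obtain ⟨x, hx⟩ := Module.End.HasEigenvalue.exists_hasEigenvector hmem
    exact ⟨x, hx.2, by simpa using hx.apply_eq_smul⟩

/-- `L` is the largest eigenvalue of `M`: it bounds the quadratic form and has a nonnegative
eigenvector. -/
structure IsPerronValue {V : Type*} [Fintype V] (M : Matrix V V ℝ) (L : ℝ) : Prop where
  le : ∀ x : V → ℝ, x ⬝ᵥ M *ᵥ x ≤ L * (x ⬝ᵥ x)
  exists_eigenvector : ∃ x : V → ℝ, x ≠ 0 ∧ (∀ i, 0 ≤ x i) ∧ M *ᵥ x = L • x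

lemma dotProduct_mulVec_eq_sum {V : Type*} [Fintype V] (M : Matrix V V ℝ) (x : V → ℝ) :
    x ⬝ᵥ M *ᵥ x = ∑ i, ∑ j, M i j * (x i * x j) := by
  simp only [dotProduct, mulVec, mul_sum]
  exact sum_congr rfl fun i _ => sum_congr rfl fun j _ => by ring

lemma dotProduct_self_pos_of_ne_zero {V : Type*} [Fintype V] {x : V → ℝ} (hx : x ≠ 0) :
    0 < x ⬝ᵥ x := by
  refine lt_of_le_of_ne (sum_nonneg fun i _ => mul_self_nonneg _) fun h => hx ?_
  exact dotProduct_self_eq_zero.1 h.symm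

lemma isPerronValue_sSup {V : Type*} [Fintype V] [Nonempty V] (M : Matrix V V ℝ)
    (hM : M.IsHermitian) (hnn : ∀ i j, 0 ≤ M i j) :
    IsPerronValue M (sSup {μ : ℝ | Module.End.HasEigenvalue (Matrix.toLin' M) μ}) := by
  obtain ⟨hpsd, x, hx0, hx⟩ := sSup_eigenvalue_spec M hM
  set L := sSup {μ : ℝ | Module.End.HasEigenvalue (Matrix.toLin' M) μ}
  have hform : ∀ y : V → ℝ, y ⬝ᵥ (L • (1 : Matrix V V ℝ) - M) *ᵥ y =
      L * (y ⬝ᵥ y) - y ⬝ᵥ M *ᵥ y := by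
    intro y
    simp [sub_mulVec, smul_mulVec, dotProduct_sub]
  have hle : ∀ y : V → ℝ, y ⬝ᵥ M *ᵥ y ≤ L * (y ⬝ᵥ y) := by
    intro y
    have := hpsd.dotProduct_mulVec_nonneg y
    rw [star_trivial, hform] at this
    linarith
  refine ⟨hle, fun i => |x i|, ?_, fun i => abs_nonneg _, ?_⟩
  · intro h
    exact hx0 (funext fun i => abs_eq_zero.1 (congrFun h i))
  · set y : V → ℝ := fun i => |x i|
    have hyy : y ⬝ᵥ y = x ⬝ᵥ x := sum_congr rfl fun i _ => abs_mul_abs_self _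
    have hge : L * (y ⬝ᵥ y) ≤ y ⬝ᵥ M *ᵥ y := by
      have : L * (x ⬝ᵥ x) = x ⬝ᵥ M *ᵥ x := by rw [hx, dotProduct_smul, smul_eq_mul]
      rw [hyy, this, dotProduct_mulVec_eq_sum, dotProduct_mulVec_eq_sum]
      refine sum_le_sum fun i _ => sum_le_sum fun j _ => mul_le_mul_of_nonneg_left ?_ (hnn i j)
      rw [← abs_mul]
      exact le_abs_self _
    have h0 : (L • (1 : Matrix V V ℝ) - M) *ᵥ y = 0 := by
      refine (hpsd.dotProduct_mulVec_zero_iff y).1 ?_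
      rw [star_trivial, hform]
      linarith [hle y]
    rw [sub_mulVec, smul_mulVec, one_mulVec, sub_eq_zero] at h0
    exact h0.symm

lemma IsPerronValue.le_of_le {V : Type*} [Fintype V] {M N : Matrix V V ℝ} {L K : ℝ}
    (hM : IsPerronValue M L) (hN : ∀ x : V → ℝ, (∀ i, 0 ≤ x i) → x ⬝ᵥ N *ᵥ x ≤ K * (x ⬝ᵥ x))
    (hMN : ∀ i j, M i j ≤ N i j) : L ≤ K := by
  obtain ⟨x, hx0, hxnn, hx⟩ := hM.exists_eigenvector
  have h1 : L * (x ⬝ᵥ x) = x ⬝ᵥ M *ᵥ x := by rw [hx, dotProduct_smul, smul_eq_mul]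
  have h2 : x ⬝ᵥ M *ᵥ x ≤ x ⬝ᵥ N *ᵥ x := by
    rw [dotProduct_mulVec_eq_sum, dotProduct_mulVec_eq_sum]
    exact sum_le_sum fun i _ => sum_le_sum fun j _ =>
      mul_le_mul_of_nonneg_right (hMN i j) (mul_nonneg (hxnn i) (hxnn j))
  exact le_of_mul_le_mul_right (by linarith [hN x hxnn]) (dotProduct_self_pos_of_ne_zero hx0)

lemma IsPerronValue.lt_of_le_of_lt {V : Type*} [Fintype V] {M N : Matrix V V ℝ} {L K : ℝ}
    (hM : IsPerronValue M L) (hN : ∀ x : V → ℝ, (∀ i, 0 ≤ x i) → x ⬝ᵥ N *ᵥ x ≤ K * (x ⬝ᵥ x))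
    (hnn : ∀ i j, 0 ≤ M i j) (hpos : ∀ i j, i ≠ j → 0 < M i j)
    (hMN : ∀ i j, M i j ≤ N i j) {a b : V} (hlt : M a b < N a b) : L < K := by
  obtain ⟨x, hx0, hxnn, hx⟩ := hM.exists_eigenvector
  have hxx := dotProduct_self_pos_of_ne_zero hx0
  have hxpos : ∀ i, 0 < x i := by
    by_contra! ⟨i, hi⟩
    have hi0 : x i = 0 := le_antisymm hi (hxnn i)
    have hsum : ∑ j, M i j * x j = 0 := by
      have := congrFun hx i
      simpa [mulVec, dotProduct, hi0] using this
    rw [sum_eq_zero_iff_of_nonneg fun j _ => mul_nonneg (hnn i j) (hxnn j)] at hsum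
    refine hx0 (funext fun j => ?_)
    by_cases hij : i = j
    · rw [← hij, hi0]; rfl
    · exact (mul_eq_zero.1 (hsum j (mem_univ j))).resolve_left (hpos i j hij).ne'
  have h1 : L * (x ⬝ᵥ x) = x ⬝ᵥ M *ᵥ x := by rw [hx, dotProduct_smul, smul_eq_mul]
  have hle : ∀ i j, M i j * (x i * x j) ≤ N i j * (x i * x j) := fun i j =>
    mul_le_mul_of_nonneg_right (hMN i j) (mul_nonneg (hxnn i) (hxnn j))
  have h2 : x ⬝ᵥ M *ᵥ x < x ⬝ᵥ N *ᵥ x := by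
    rw [dotProduct_mulVec_eq_sum, dotProduct_mulVec_eq_sum]
    refine sum_lt_sum (fun i _ => sum_le_sum fun j _ => hle i j) ⟨a, mem_univ a, ?_⟩
    exact sum_lt_sum (fun j _ => hle a j) ⟨b, mem_univ b,
      mul_lt_mul_of_pos_right hlt (mul_pos (hxpos a) (hxpos b))⟩
  exact lt_of_mul_lt_mul_right (by linarith [hN x hxnn]) hxx.le

/-- The matrix with zero diagonal whose off-diagonal entries depend only on the classes `κ i`,
`κ j` of the indices. -/
noncomputable def blockMatrix {V κ' : Type*} (κ : V → κ') (Φ : κ' → κ' → ℝ) : Matrix V V ℝ :=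
  Matrix.of fun i j => if i = j then 0 else Φ (κ i) (κ j)

lemma blockMatrix_mulVec {V κ' : Type*} [Fintype V] [Fintype κ'] [DecidableEq κ']
    (κ : V → κ')
    (Φ : κ' → κ' → ℝ) (hΦ : ∀ k, Φ k k = 1 / 2) (z : V → ℝ) (i : V) :
    (blockMatrix κ Φ *ᵥ z) i = ∑ k, Φ (κ i) k * (∑ j with κ j = k, z j) - z i / 2 := by
  have h1 : ∀ j, blockMatrix κ Φ i j * z j
      = Φ (κ i) (κ j) * z j - if i = j then z j / 2 else 0 := by
    intro j
    by_cases h : i = j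
    · subst h
      simp [blockMatrix, hΦ]
      ring
    · simp [blockMatrix, h]
  simp only [mulVec, dotProduct, h1, sum_sub_distrib, sum_ite_eq, mem_univ, if_true]
  congr 1
  rw [← sum_fiberwise univ κ]
  refine sum_congr rfl fun k _ => ?_
  rw [mul_sum]
  exact sum_congr rfl fun j hj => by rw [(mem_filter.1 hj).2]

lemma dotProduct_blockMatrix_mulVec {V κ' : Type*} [Fintype V] [Fintype κ'] [DecidableEq κ']
    (κ : V → κ')
    (Φ : κ' → κ' → ℝ) (hΦ : ∀ k, Φ k k = 1 / 2) (z : V → ℝ) :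
    z ⬝ᵥ blockMatrix κ Φ *ᵥ z =
      ∑ k, ∑ l, Φ k l * (∑ j with κ j = k, z j) * (∑ j with κ j = l, z j) - z ⬝ᵥ z / 2 := by
  have h1 : ∀ i, z i * (blockMatrix κ Φ *ᵥ z) i =
      z i * (∑ k, Φ (κ i) k * (∑ j with κ j = k, z j)) - z i * z i / 2 := by
    intro i
    rw [blockMatrix_mulVec κ Φ hΦ]
    ring
  rw [dotProduct, sum_congr rfl fun i _ => h1 i, sum_sub_distrib, dotProduct, sum_div]
  congr 1
  rw [← sum_fiberwise univ κ]
  refine sum_congr rfl fun k _ => ?_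
  rw [sum_congr rfl fun i hi => by rw [(mem_filter.1 hi).2], ← sum_mul, mul_comm, sum_mul]
  exact sum_congr rfl fun l _ => by ring

/-- Vertices are classified by side of the bipartition (first component) and membership in a
vertex cover (second component). This is the reciprocal distance of two distinct vertices when all
edges between the two sides meeting the cover are present. -/
noncomputable def coverKernel (k l : Bool × Bool) : ℝ :=
  if k.1 = l.1 then 1 / 2 else if k.2 = true ∨ l.2 = true then 1 else 1 / 3

lemma coverKernel_comm (k l : Bool × Bool) : coverKernel k l = coverKernel l k := by
  simp only [coverKernel, eq_comm (a := k.1), or_comm (a := k.2 = true)]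

/-- The reciprocal distance in the complete bipartite graph between a cover and its complement. -/
noncomputable def bipartiteKernel (k l : Bool × Bool) : ℝ :=
  if k.2 = l.2 then 1 / 2 else 1

/-- The key inequality between the class sums of a Perron vector. -/
lemma class_sum_inequality {s t m r x₁ x₂ y₁ y₂ α : ℝ} (hs : 0 ≤ s) (ht : 0 ≤ t) (hm : 0 < m)
    (hr : 0 < r) (htm : t ≤ m) (hsr : s ≤ r) (hα : 0 < α) (hx₁ : 0 < x₁) (hx₂ : 0 < x₂)
    (hy₁ : 0 < y₁) (hy₂ : 0 < y₂)
    (e₁ : α * x₁ = (s * x₁ + m * x₂) / 2 + t * y₁ + r * y₂)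
    (e₂ : α * x₂ = (s * x₁ + m * x₂) / 2 + t * y₁ + r * y₂ / 3)
    (f₁ : α * y₁ = (t * y₁ + r * y₂) / 2 + s * x₁ + m * x₂)
    (f₂ : α * y₂ = (t * y₁ + r * y₂) / 2 + s * x₁ + m * x₂ / 3) :
    (s * x₁) * (t * y₁) <
      (s * x₁) * (m * x₂) + (t * y₁) * (r * y₂) + (m * x₂) * (r * y₂) / 3 := by
  have hαt : 3 / 2 * t ≤ α := by
    refine le_of_mul_le_mul_right (a := x₂ + y₁) ?_ (by positivity)
    have h1 : t * x₂ ≤ m * x₂ := mul_le_mul_of_nonneg_right htm hx₂.le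
    have h2 : 0 ≤ s * x₁ := by positivity
    have h3 : 0 ≤ r * y₂ := by positivity
    linarith
  have hαs : 3 / 2 * s ≤ α := by
    refine le_of_mul_le_mul_right (a := x₁ + y₂) ?_ (by positivity)
    have h1 : s * y₂ ≤ r * y₂ := mul_le_mul_of_nonneg_right hsr hy₂.le
    have h2 : 0 ≤ t * y₁ := by positivity
    have h3 : 0 ≤ m * x₂ := by positivity
    linarith
  obtain ⟨c, hc⟩ : ∃ c, c = 2 / 3 / α := ⟨_, rfl⟩
  have hc0 : 0 < c := by rw [hc]; positivity
  have hcα : c * α = 2 / 3 := by rw [hc]; field_simp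
  have hx : x₁ = x₂ + c * (r * y₂) := by
    refine mul_left_cancel₀ hα.ne' ?_
    linear_combination e₁ - e₂ - (r * y₂) * hcα
  have hy : y₁ = y₂ + c * (m * x₂) := by
    refine mul_left_cancel₀ hα.ne' ?_
    linear_combination f₁ - f₂ - (m * x₂) * hcα
  have hcs : c * s ≤ 4 / 9 := by
    linarith [mul_le_mul_of_nonneg_left hαs hc0.le]
  have hct : c * t ≤ 4 / 9 := by
    linarith [mul_le_mul_of_nonneg_left hαt hc0.le]
  have ha : t * x₂ ≤ m * x₂ := mul_le_mul_of_nonneg_right htm hx₂.le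
  have hb : s * y₂ ≤ r * y₂ := mul_le_mul_of_nonneg_right hsr hy₂.le
  have ha0 : 0 < m * x₂ := by positivity
  have hb0 : 0 < r * y₂ := by positivity
  generalize m * x₂ = a at *
  generalize r * y₂ = b at *
  have k₁ : s * x₂ * (t * x₂) * (5 / 9) ≤ s * x₂ * a * (1 - c * t) :=
    mul_le_mul (mul_le_mul_of_nonneg_left ha (by positivity)) (by linarith) (by norm_num)
      (by positivity)
  have k₂ : t * y₂ * (s * y₂) * (5 / 9) ≤ t * y₂ * b * (1 - c * s) :=
    mul_le_mul (mul_le_mul_of_nonneg_left hb (by positivity)) (by linarith) (by norm_num)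
      (by positivity)
  have k₃ : 0 ≤ (a * b) * ((c * s) * (1 - c * t) + c * t) := by
    have : 0 ≤ 1 - c * t := by linarith
    positivity
  have k₄ : 0 ≤ s * t * (x₂ - y₂) ^ 2 := by positivity
  have k₅ : 0 ≤ s * t * (x₂ * y₂) := by positivity
  have k₆ : 0 < a * b := by positivity
  rw [hx, hy]
  nlinarith

lemma isPerronValue_coverKernel_lt {V : Type*} [Fintype V] (κ : V → Bool × Bool)
    (h₁ : #{i | κ i = (true, true)} ≤ #{i | κ i = (false, false)})
    (h₂ : #{i | κ i = (false, true)} ≤ #{i | κ i = (true, false)})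
    (h₃ : 0 < #{i | κ i = (true, false)}) (h₄ : 0 < #{i | κ i = (false, false)}) {L K : ℝ}
    (hL : IsPerronValue (blockMatrix κ coverKernel) L)
    (hK : ∀ x : V → ℝ, (∀ i, 0 ≤ x i) →
      x ⬝ᵥ blockMatrix κ bipartiteKernel *ᵥ x ≤ K * (x ⬝ᵥ x)) : L < K := by
  obtain ⟨z, hz0, hznn, hz⟩ := hL.exists_eigenvector
  have hzz := dotProduct_self_pos_of_ne_zero hz0
  have hΦ : ∀ k, coverKernel k k = 1 / 2 := fun k => by simp [coverKernel]
  have hΨ : ∀ k, bipartiteKernel k k = 1 / 2 := fun k => by simp [bipartiteKernel]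
  have hLz : L * (z ⬝ᵥ z) = z ⬝ᵥ blockMatrix κ coverKernel *ᵥ z := by
    rw [hz, dotProduct_smul, smul_eq_mul]
  set S : Bool × Bool → ℝ := fun k => ∑ j with κ j = k, z j with hS
  have hSnn : ∀ k, 0 ≤ S k := fun k => sum_nonneg fun j _ => hznn j
  have hSpos : 0 < ∑ k, S k := by
    rw [hS, sum_fiberwise]
    obtain ⟨i, hi⟩ := Function.ne_iff.1 hz0
    exact sum_pos' (fun i _ => hznn i) ⟨i, mem_univ i, lt_of_le_of_ne (hznn i) (Ne.symm hi)⟩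
  have hL0 : 0 ≤ L := by
    refine nonneg_of_mul_nonneg_left ?_ hzz
    rw [hLz, dotProduct_mulVec_eq_sum]
    refine sum_nonneg fun i _ => sum_nonneg fun j _ => mul_nonneg ?_ (mul_nonneg (hznn i) (hznn j))
    simp only [blockMatrix, coverKernel, of_apply]
    split_ifs <;> norm_num
  set α : ℝ := L + 1 / 2 with hα
  have hα0 : 0 < α := by positivity
  set X : Bool × Bool → ℝ := fun k => (∑ l, coverKernel k l * S l) / α with hX
  have hαX : ∀ k, α * X k = ∑ l, coverKernel k l * S l := fun k => by
    simp only [hX]; field_simp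
  have hzX : ∀ i, z i = X (κ i) := by
    intro i
    refine mul_left_cancel₀ hα0.ne' ?_
    have h := congrFun hz i
    rw [blockMatrix_mulVec κ _ hΦ, Pi.smul_apply, smul_eq_mul] at h
    rw [hαX, hα]
    linarith
  have hSX : ∀ k, S k = #{i | κ i = k} * X k := by
    intro k
    rw [hS, ← nsmul_eq_mul, ← sum_const]
    exact sum_congr rfl fun i hi => by rw [hzX i, (mem_filter.1 hi).2]
  have hXpos : ∀ k, 0 < X k := by
    intro k
    refine div_pos ?_ hα0
    calc (0 : ℝ) < 1 / 3 * ∑ l, S l := by positivity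
      _ ≤ _ := by
        rw [mul_sum]
        refine sum_le_sum fun l _ => mul_le_mul_of_nonneg_right ?_ (hSnn l)
        simp only [coverKernel]
        split_ifs <;> norm_num
  have hform : ∀ Ψ : Bool × Bool → Bool × Bool → ℝ, (∀ k, Ψ k k = 1 / 2) →
      z ⬝ᵥ blockMatrix κ Ψ *ᵥ z = ∑ k, ∑ l, Ψ k l * S k * S l - z ⬝ᵥ z / 2 :=
    fun Ψ h => dotProduct_blockMatrix_mulVec κ Ψ h z
  have key := class_sum_inequality (s := #{i | κ i = (true, true)})
    (t := #{i | κ i = (false, true)}) (m := #{i | κ i = (true, false)})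
    (r := #{i | κ i = (false, false)}) (Nat.cast_nonneg _) (Nat.cast_nonneg _) (Nat.cast_pos.2 h₃)
    (Nat.cast_pos.2 h₄) (Nat.cast_le.2 h₂) (Nat.cast_le.2 h₁) hα0
    (hXpos (true, true)) (hXpos (true, false)) (hXpos (false, true)) (hXpos (false, false))
  simp only [← hSX, hαX] at key
  clear_value S X α
  simp only [Fintype.sum_prod_type, Fintype.sum_bool, coverKernel, reduceCtorEq, if_true, if_false,
    or_true, or_false, or_self] at key
  have hkey := key (by ring) (by ring) (by ring) (by ring)
  have hlt : z ⬝ᵥ blockMatrix κ coverKernel *ᵥ z < z ⬝ᵥ blockMatrix κ bipartiteKernel *ᵥ z := by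
    rw [hform _ hΦ, hform _ hΨ]
    refine sub_lt_sub_right ?_ _
    simp only [Fintype.sum_prod_type, Fintype.sum_bool, coverKernel, bipartiteKernel]
    norm_num
    linarith
  exact lt_of_mul_lt_mul_right (by linarith [hK z hznn]) hzz.le

lemma isPerronValue_hararyRho {V : Type*} [Fintype V] [Nonempty V] (G : SimpleGraph V) :
    IsPerronValue (hararyMatrix G) (hararyRho G) := by
  have hinst : ‹Fintype V› = Fintype.ofFinite V := Subsingleton.elim _ _
  rw [hararyRho, ← hinst]
  refine isPerronValue_sSup _ ?_ fun i j => ?_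
  · ext i j
    simp [hararyMatrix, SimpleGraph.dist_comm, eq_comm]
  · simp only [hararyMatrix, of_apply]
    split_ifs <;> positivity

/-- A minimum vertex cover of a bipartite graph can be injectively matched into its complement. -/
lemma exists_cover_matched_to_compl {V : Type*} [Fintype V] (G : SimpleGraph V) (c : V → Bool)
    (hc : ∀ u v, G.Adj u v → c u ≠ c v) :
    ∃ C : Finset V, (∀ u v, G.Adj u v → u ∈ C ∨ v ∈ C) ∧
      ∃ f : C → V, Function.Injective f ∧ ∀ x : C, G.Adj x (f x) ∧ f x ∉ C := by
  obtain ⟨C, hCmem, hmin⟩ := exists_min_image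
    (univ.filter fun C : Finset V => ∀ u v, G.Adj u v → u ∈ C ∨ v ∈ C) card
    ⟨univ, by simp⟩
  have hC : ∀ u v, G.Adj u v → u ∈ C ∨ v ∈ C := (mem_filter.1 hCmem).2
  refine ⟨C, hC, ?_⟩
  rw [← Fintype.all_card_le_filter_rel_iff_exists_injective
    (fun (x : C) (y : V) => G.Adj x y ∧ y ∉ C)]
  intro A
  have hmono : ∀ b : Bool, #(A.filter fun x : C => c x = b) ≤
      #{y | (∃ a ∈ A, G.Adj a y ∧ y ∉ C) ∧ c y = !b} := by
    intro b
    set S : Finset V := (A.filter fun x : C => c x = b).map (Function.Embedding.subtype _) with hS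
    set N : Finset V := {y | (∃ a ∈ A, G.Adj a y ∧ y ∉ C) ∧ c y = !b} with hN
    have hSC : S ⊆ C := by
      intro x hx
      simp only [hS, mem_map, Function.Embedding.subtype_apply] at hx
      obtain ⟨y, -, rfl⟩ := hx
      exact y.2
    have hmemS : ∀ u, u ∈ S → c u = b ∧ ∃ a ∈ A, (a : V) = u := by
      intro u hu
      simp only [hS, mem_map, Function.Embedding.subtype_apply, mem_filter] at hu
      obtain ⟨y, ⟨hy, hy'⟩, rfl⟩ := hu
      exact ⟨hy', y, hy, rfl⟩
    have hcov : ∀ u v, G.Adj u v → u ∈ S → v ∈ C \ S ∪ N := by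
      intro u v huv hu
      obtain ⟨hub, a, ha, rfl⟩ := hmemS u hu
      have hcv : c v = !b := by
        have := hc _ _ huv
        rw [hub] at this
        exact Bool.eq_not_iff.2 this.symm
      rw [mem_union, mem_sdiff]
      by_cases hv : v ∈ C
      · refine Or.inl ⟨hv, fun hvS => ?_⟩
        rw [(hmemS v hvS).1] at hcv
        cases b <;> simp at hcv
      · exact Or.inr (mem_filter.2 ⟨mem_univ _, ⟨a, ha, huv, hv⟩, hcv⟩)
    have hcard := hmin (C \ S ∪ N) (by
      refine mem_filter.2 ⟨mem_univ _, fun u v huv => ?_⟩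
      by_cases hu : u ∈ S
      · exact Or.inr (hcov u v huv hu)
      by_cases hv : v ∈ S
      · exact Or.inl (hcov v u huv.symm hv)
      rcases hC u v huv with h | h
      · exact Or.inl (mem_union_left _ (mem_sdiff.2 ⟨h, hu⟩))
      · exact Or.inr (mem_union_left _ (mem_sdiff.2 ⟨h, hv⟩)))
    have h1 := card_union_le (C \ S) N
    have h2 := card_sdiff_add_card_eq_card hSC
    have h3 : #S = #(A.filter fun x : C => c x = b) := card_map _
    omega
  have e₁ := card_filter_add_card_filter_not (s := A) (fun x : C => c x = true)
  have e₂ := card_filter_add_card_filter_not (s := {y | ∃ a ∈ A, G.Adj a y ∧ y ∉ C})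
    (fun y : V => c y = true)
  simp only [Bool.not_eq_true, filter_filter] at e₁ e₂
  have t := hmono true
  have f := hmono false
  simp only [Bool.not_true, Bool.not_false] at t f
  omega

/-- If a vertex cover can be matched into its complement, its size is the matching number. -/
lemma matchingNumber_eq_card_cover {V : Type*} [Fintype V] [Nonempty V] (G : SimpleGraph V)
    (C : Finset V)
    (hC : ∀ u v, G.Adj u v → u ∈ C ∨ v ∈ C) (f : C → V) (hf : Function.Injective f)
    (hadj : ∀ x : C, G.Adj x (f x) ∧ f x ∉ C) : matchingNumber G = #C := by
  refine IsGreatest.csSup_eq ⟨?_, ?_⟩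
  · let M : G.Subgraph :=
      { verts := {v | v ∈ C ∨ ∃ x, f x = v}
        Adj := fun u v => ∃ x : C, (u = x ∧ v = f x) ∨ (v = x ∧ u = f x)
        adj_sub := by
          rintro u v ⟨x, ⟨rfl, rfl⟩ | ⟨rfl, rfl⟩⟩
          · exact (hadj x).1
          · exact (hadj x).1.symm
        edge_vert := by
          rintro u v ⟨x, ⟨rfl, rfl⟩ | ⟨rfl, rfl⟩⟩
          · exact Or.inl x.2
          · exact Or.inr ⟨x, rfl⟩
        symm := ⟨by
          rintro u v ⟨x, h⟩
          exact ⟨x, h.symm⟩⟩ }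
    refine ⟨M, ?_, ?_⟩
    · rintro v (hv | ⟨x, rfl⟩)
      · refine ⟨f ⟨v, hv⟩, ⟨⟨v, hv⟩, Or.inl ⟨rfl, rfl⟩⟩, ?_⟩
        rintro w ⟨x, ⟨rfl, rfl⟩ | ⟨rfl, rfl⟩⟩
        · rfl
        · exact absurd hv (hadj x).2
      · refine ⟨x, ⟨x, Or.inr ⟨rfl, rfl⟩⟩, ?_⟩
        rintro w ⟨y, ⟨h, rfl⟩ | ⟨rfl, h⟩⟩
        · exact absurd (h ▸ y.2) (hadj x).2
        · rw [hf h]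
    · have hedge : M.edgeSet = Set.range fun x : C => s((x : V), f x) := by
        ext e
        induction e with
        | _ u v =>
          rw [SimpleGraph.Subgraph.mem_edgeSet]
          simp only [Set.mem_range, Sym2.eq_iff]
          constructor
          · rintro ⟨x, ⟨rfl, rfl⟩ | ⟨rfl, rfl⟩⟩
            · exact ⟨x, Or.inl ⟨rfl, rfl⟩⟩
            · exact ⟨x, Or.inr ⟨rfl, rfl⟩⟩
          · rintro ⟨x, ⟨rfl, rfl⟩ | ⟨rfl, rfl⟩⟩
            · exact ⟨x, Or.inl ⟨rfl, rfl⟩⟩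
            · exact ⟨x, Or.inr ⟨rfl, rfl⟩⟩
      have hinj : Function.Injective fun x : C => s((x : V), f x) := by
        intro x y hxy
        rcases Sym2.eq_iff.1 hxy with ⟨h, -⟩ | ⟨h, -⟩
        · exact Subtype.ext h
        · exact absurd (h ▸ x.2) (hadj y).2
      rw [hedge, ← Set.image_univ, Set.ncard_image_of_injective _ hinj, Set.ncard_univ,
        Nat.card_eq_fintype_card, Fintype.card_coe]
  · rintro m ⟨M, hM, rfl⟩
    have hex : ∀ e ∈ M.edgeSet, ∃ v ∈ C, v ∈ e := by
      intro e
      induction e with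
      | _ u v =>
        intro he
        rcases hC u v (M.adj_sub he) with h | h
        · exact ⟨u, h, Sym2.mem_mk_left u v⟩
        · exact ⟨v, h, Sym2.mem_mk_right u v⟩
    choose! g hgC hg using hex
    rw [← Set.ncard_coe_finset]
    refine Set.ncard_le_ncard_of_injOn g hgC ?_ (finite_toSet C)
    intro e he e' he' hgg
    have h1 := hg e he
    have h2 := hg e' he'
    rw [← hgg] at h2
    obtain ⟨u, hu⟩ := Sym2.mem_iff_exists.1 h1
    obtain ⟨w, hw⟩ := Sym2.mem_iff_exists.1 h2
    rw [hu] at he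
    rw [hw] at he'
    rw [hu, hw, hM.eq_of_adj_left (SimpleGraph.Subgraph.mem_edgeSet.1 he)
      (SimpleGraph.Subgraph.mem_edgeSet.1 he')]

/-- Reciprocal distances in a connected bipartite graph with a given vertex cover. -/
lemma hararyMatrix_le_blockMatrix {V : Type*} [Fintype V] {G : SimpleGraph V} (hG : G.Connected)
    {c : V → Bool} (hc : ∀ u v, G.Adj u v → c u ≠ c v) {C : Finset V}
    (hC : ∀ u v, G.Adj u v → u ∈ C ∨ v ∈ C) (i j : V) :
    hararyMatrix G i j ≤ blockMatrix (fun v => (c v, decide (v ∈ C))) coverKernel i j := by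
  simp only [hararyMatrix, blockMatrix, of_apply, coverKernel, decide_eq_true_eq]
  by_cases hij : i = j
  · simp [hij]
  rw [if_neg hij, if_neg hij]
  have h0 : 0 < G.dist i j := hG.pos_dist_of_ne hij
  have hnadj : ¬ G.Adj i j → 2 ≤ G.dist i j := by
    intro h
    have := mt SimpleGraph.dist_eq_one_iff_adj.1 h
    omega
  split_ifs with h1 h2
  · have h2 : (2 : ℝ) ≤ G.dist i j := by
      exact_mod_cast hnadj fun h => hc i j h h1
    rw [one_div]
    exact inv_anti₀ (by norm_num) h2
  · exact inv_le_one_of_one_le₀ (by exact_mod_cast h0)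
  · have h3 : (3 : ℝ) ≤ G.dist i j := by
      have hge := hnadj fun h => h2 (hC i j h)
      have hne : G.dist i j ≠ 2 := by
        intro hd
        obtain ⟨w, hw⟩ := hG.exists_walk_length_eq_dist i j
        rw [hd] at hw
        match w, hw with
        | .cons (v := v) ha (.cons hb .nil), _ =>
          exact h1 ((Bool.eq_not_iff.2 (hc _ _ ha)).trans (Bool.eq_not_iff.2 (hc _ _ hb).symm).symm)
      have : 3 ≤ G.dist i j := by omega
      exact_mod_cast this
    rw [one_div]
    exact inv_anti₀ (by norm_num) h3

lemma hararyMatrix_pos {V : Type*} [Fintype V] {G : SimpleGraph V} (hG : G.Connected) {i j : V}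
    (hij : i ≠ j) : 0 < hararyMatrix G i j := by
  have := hG.pos_dist_of_ne hij
  simp only [hararyMatrix, of_apply, if_neg hij]
  positivity

lemma hararyMatrix_lt_one {V : Type*} [Fintype V] {G : SimpleGraph V} (hG : G.Connected) {i j : V}
    (hij : ¬ G.Adj i j) : hararyMatrix G i j < 1 := by
  simp only [hararyMatrix, of_apply]
  split_ifs with h
  · exact one_pos
  have h0 := hG.pos_dist_of_ne h
  have h1 := mt SimpleGraph.dist_eq_one_iff_adj.1 hij
  exact inv_lt_one_of_one_lt₀ (by exact_mod_cast (by omega : 1 < G.dist i j))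

lemma le_hararyMatrix_completeBipartiteGraph {α β : Type*} [Finite α] [Finite β] [Nonempty α]
    [Nonempty β] {x y : α ⊕ β} (hxy : x ≠ y) :
    (if x.isLeft = y.isLeft then 1 / 2 else 1 : ℝ) ≤
      hararyMatrix (completeBipartiteGraph α β) x y := by
  rw [hararyMatrix, of_apply, if_neg hxy]
  have key : ∀ z, (completeBipartiteGraph α β).Adj x z → (completeBipartiteGraph α β).Adj z y →
      (1 / 2 : ℝ) ≤ ((completeBipartiteGraph α β).dist x y : ℝ)⁻¹ := by
    intro z h1 h2
    let w : (completeBipartiteGraph α β).Walk x y := .cons h1 (.cons h2 .nil)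
    have hle : (completeBipartiteGraph α β).dist x y ≤ 2 := SimpleGraph.dist_le w
    have hpos := w.reachable.pos_dist_of_ne hxy
    rw [one_div]
    exact inv_anti₀ (by exact_mod_cast hpos) (by exact_mod_cast hle)
  obtain ⟨a₀⟩ := ‹Nonempty α›
  obtain ⟨b₀⟩ := ‹Nonempty β›
  rcases x with a | b <;> rcases y with a' | b'
  · simpa using key (.inr b₀) (by simp) (by simp)
  · rw [SimpleGraph.dist_eq_one_iff_adj.2 (by simp)]; simp
  · rw [SimpleGraph.dist_eq_one_iff_adj.2 (by simp)]; simp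
  · simpa using key (.inl a₀) (by simp) (by simp)

/-- The quadratic form bound for a complete bipartite graph, transported along a bijection. -/
lemma dotProduct_blockMatrix_le_hararyRho {V : Type*} [Fintype V] {α β : Type*} [Fintype α]
    [Fintype β] [Nonempty α] [Nonempty β] (κ : V → Bool × Bool) (e : V ≃ α ⊕ β)
    (he : ∀ v, (e v).isLeft = (κ v).2) (x : V → ℝ) (hx : ∀ i, 0 ≤ x i) :
    x ⬝ᵥ blockMatrix κ bipartiteKernel *ᵥ x ≤
      hararyRho (completeBipartiteGraph α β) * (x ⬝ᵥ x) := by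
  have h := (isPerronValue_hararyRho (completeBipartiteGraph α β)).le (x ∘ e.symm)
  have hxx : (x ∘ e.symm) ⬝ᵥ (x ∘ e.symm) = x ⬝ᵥ x := by
    simp only [dotProduct, Function.comp_apply]
    exact e.symm.sum_comp fun i => x i * x i
  rw [hxx] at h
  refine le_trans ?_ h
  rw [dotProduct_mulVec_eq_sum, dotProduct_mulVec_eq_sum, ← e.sum_comp]
  refine sum_le_sum fun i _ => ?_
  rw [← e.sum_comp]
  refine sum_le_sum fun j _ => ?_
  simp only [Function.comp_apply, Equiv.symm_apply_apply]
  refine mul_le_mul_of_nonneg_right ?_ (mul_nonneg (hx i) (hx j))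
  by_cases hij : i = j
  · simp [blockMatrix, hararyMatrix, hij]
  · have := le_hararyMatrix_completeBipartiteGraph (e.injective.ne hij)
    rw [he, he] at this
    simpa [blockMatrix, hij, bipartiteKernel] using this

/-- A subset of a finite type and its complement, enumerated. -/
lemma exists_equiv_fin_sum_fin {V : Type*} [Fintype V] (C : Finset V) :
    ∃ e : V ≃ Fin #C ⊕ Fin (Fintype.card V - #C), ∀ v, (e v).isLeft = decide (v ∈ C) := by
  refine ⟨(Equiv.sumCompl (· ∈ C)).symm.trans (Equiv.sumCongr
    (Fintype.equivFinOfCardEq (by simp)) (Fintype.equivFinOfCardEq (by simp))), fun v => ?_⟩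
  by_cases hv : v ∈ C
  · simp [Equiv.sumCompl_symm_apply_of_pos hv, hv]
  · simp [Equiv.sumCompl_symm_apply_of_neg hv, hv]

theorem hararyRho_lt_of_matchingNumber {V : Type*} [Fintype V] (G : SimpleGraph V)
    (hG : G.Connected) (hbip : G.Colorable 2)
    (hniso : ¬ Nonempty (G ≃g completeBipartiteGraph (Fin (matchingNumber G))
      (Fin (Fintype.card V - matchingNumber G)))) :
    hararyRho G < hararyRho (completeBipartiteGraph (Fin (matchingNumber G))
      (Fin (Fintype.card V - matchingNumber G))) := by
  have := hG.nonempty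
  obtain ⟨col⟩ := hbip
  obtain ⟨c, hc⟩ : ∃ c : V → Bool, ∀ u v, G.Adj u v → c u ≠ c v := by
    refine ⟨fun v => finTwoEquiv (col v), fun u v huv => ?_⟩
    exact finTwoEquiv.injective.ne (col.valid huv)
  obtain ⟨C, hC, f, hf, hfadj⟩ := exists_cover_matched_to_compl G c hc
  rw [matchingNumber_eq_card_cover G C hC f hf hfadj] at hniso ⊢
  obtain ⟨e, he⟩ := exists_equiv_fin_sum_fin C
  set κ : V → Bool × Bool := fun v => (c v, decide (v ∈ C)) with hκ
  have hbound : ∀ u v, u ∈ C → v ∉ C → ∀ x : V → ℝ, (∀ i, 0 ≤ x i) →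
      x ⬝ᵥ blockMatrix κ bipartiteKernel *ᵥ x ≤ hararyRho (completeBipartiteGraph (Fin #C)
        (Fin (Fintype.card V - #C))) * (x ⬝ᵥ x) := by
    intro u v hu hv
    have : Nonempty (Fin #C) := ⟨⟨0, card_pos.2 ⟨u, hu⟩⟩⟩
    have : Nonempty (Fin (Fintype.card V - #C)) :=
      ⟨⟨0, Nat.sub_pos_of_lt (card_lt_univ_of_notMem hv)⟩⟩
    exact dotProduct_blockMatrix_le_hararyRho κ e he
  have hρG := isPerronValue_hararyRho G
  have hle := hararyMatrix_le_blockMatrix hG hc hC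
  by_cases hcase : (∃ u, κ u = (true, false)) ∧ ∃ v, κ v = (false, false)
  · obtain ⟨⟨u, hu⟩, v, hv⟩ := hcase
    have huC : u ∉ C := by simpa [hκ] using congrArg Prod.snd hu
    have huv : u ≠ v := by
      rintro rfl
      simp [hu] at hv
    have : Nontrivial V := ⟨u, v, huv⟩
    obtain ⟨w, hw⟩ := hG.preconnected.exists_adj_of_nontrivial u
    have hwC : w ∈ C := (hC u w hw).resolve_left huC
    have hmatch : ∀ b : Bool, #{i | κ i = (b, true)} ≤ #{i | κ i = (!b, false)} := by
      intro b
      refine card_le_card_of_injOn (fun i => if h : i ∈ C then f ⟨i, h⟩ else i) ?_ ?_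
      · intro i hi
        have hi' : c i = b ∧ i ∈ C := by simpa [hκ] using hi
        have h1 := hfadj ⟨i, hi'.2⟩
        have h2 := hc _ _ h1.1
        simp only [hi'.1] at h2
        have h3 : c (f ⟨i, hi'.2⟩) = !b :=
          Bool.eq_not_iff.2 h2.symm
        simp [hκ, hi'.2, h1.2, h3]
      · intro i hi j hj hij
        have hi' : c i = b ∧ i ∈ C := by simpa [hκ] using hi
        have hj' : c j = b ∧ j ∈ C := by simpa [hκ] using hj
        simp only [dif_pos hi'.2, dif_pos hj'.2] at hij
        exact congrArg Subtype.val (hf hij)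
    have hP := isPerronValue_sSup (blockMatrix κ coverKernel) (by
      ext i j
      simp [blockMatrix, coverKernel_comm (κ j), eq_comm (a := j)]) (by
      intro i j
      simp only [blockMatrix, coverKernel, of_apply]
      split_ifs <;> norm_num)
    refine (hρG.le_of_le (fun x _ => hP.le x) hle).trans_lt ?_
    exact isPerronValue_coverKernel_lt κ (hmatch true) (hmatch false)
      (card_pos.2 ⟨u, by simpa using hu⟩) (card_pos.2 ⟨v, by simpa using hv⟩) hP
      (hbound w u hwC huC)
  · have hside : ∃ b, ∀ i, c i = xor b (decide (i ∈ C)) := by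
      obtain ⟨b, hb⟩ : ∃ b, ∀ i, i ∉ C → c i = b := by
        rw [not_and_or] at hcase
        simp only [not_exists, hκ, Prod.mk.injEq, decide_eq_false_iff_not, not_and'] at hcase
        rcases hcase with h | h
        · exact ⟨false, fun i hi => Bool.eq_false_iff.2 (h i hi)⟩
        · exact ⟨true, fun i hi => by simpa using h i hi⟩
      refine ⟨b, fun i => ?_⟩
      by_cases hi : i ∈ C
      · have h := hfadj ⟨i, hi⟩
        rw [Bool.eq_not_iff.2 (hc _ _ h.1), hb _ h.2]
        simp [hi]
      · simp [hb i hi, hi]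
    obtain ⟨b, hb⟩ := hside
    have hkernel : blockMatrix κ coverKernel = blockMatrix κ bipartiteKernel := by
      ext i j
      simp only [blockMatrix, of_apply, hκ, coverKernel, bipartiteKernel, hb]
      by_cases hi : i ∈ C <;> by_cases hj : j ∈ C <;> simp [hi, hj]
    rw [hkernel] at hle
    have hex : ∃ u v, u ∈ C ∧ v ∉ C ∧ ¬ G.Adj u v := by
      by_contra! hall
      refine hniso ⟨⟨e, fun {i j} => ?_⟩⟩
      have hi := he i
      have hj := he j
      have hcij := hc i j
      change (completeBipartiteGraph _ _).Adj (e i) (e j) ↔ _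
      rw [completeBipartiteGraph_adj, ← Sum.not_isLeft, ← Sum.not_isLeft, hi, hj]
      rw [hb, hb] at hcij
      by_cases hiC : i ∈ C <;> by_cases hjC : j ∈ C <;> simp only [hiC, hjC] at hcij ⊢
      · simpa using hcij
      · simpa using hall i j hiC hjC
      · simpa using (hall j i hjC hiC).symm
      · simpa using hcij
    obtain ⟨u, v, hu, hv, huv⟩ := hex
    refine hρG.lt_of_le_of_lt (hbound u v hu hv) (fun i j => ?_) (fun i j => hararyMatrix_pos hG)
      hle (a := u) (b := v) ?_
    · by_cases hij : i = j
      · simp [hij, hararyMatrix]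
      · exact (hararyMatrix_pos hG hij).le
    · refine (hararyMatrix_lt_one hG huv).trans_le ?_
      have : u ≠ v := by
        rintro rfl
        exact hv hu
      simp [blockMatrix, bipartiteKernel, hκ, hu, hv, this]

end

/-- Among connected bipartite graphs on `n` vertices with matching number `p`, the complete
bipartite graph `K_{p,n-p}` is the unique maximizer of the Harary spectral radius. -/
theorem harary_rho_bipartite_matching_lt (n p : ℕ) (G : SimpleGraph (Fin n))
    (hG : G.Connected) (hbip : G.Colorable 2) (hm : matchingNumber G = p)
    (hniso : ¬ Nonempty (G ≃g completeBipartiteGraph (Fin p) (Fin (n - p)))) :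
    hararyRho G < hararyRho (completeBipartiteGraph (Fin p) (Fin (n - p))) := by
  subst hm
  have h := hararyRho_lt_of_matchingNumber G hG hbip
  rw [Fintype.card_fin] at h
  exact h hniso
end
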